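/- Let 0 < a ≤ b be real constants. There is a constant C = C(a, b) > 0 such that for every integer n ≥ 4, every integer m with 2 ≤ m ≤ n/2, and all p, q ∈ (0,1) with a/(n·ln n) ≤ p ≤ b/(n·ln n) and a/(n·ln n) ≤ q ≤ b/(n·ln n), the MMAHH with acceptance operators OI and OW on Jump_m, started from x_0 uniformly distributed on {0,1}^n and s_0 = OI, has runtime T satisfying E[T] ≤ C·(n³/m)·ln n. -/

import Mathlib

open MeasureTheory
open scoped ENNReal NNReal

namespace MMAHHStmt

/-- The two acceptance operators. -/
inductive Op : Type
  | OI : Op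
  | OW : Op
  deriving DecidableEq

instance : MeasurableSpace Op := ⊤

/-- Search points: bit-strings of length `n`. -/
abbrev Point (n : ℕ) := Fin n → Bool

/-- The number of one-bits of a bit-string. -/
def ones {n : ℕ} (x : Point n) : ℕ := (Finset.univ.filter fun i => x i = true).card

/-- The all-ones string, the global optimum of all benchmarks considered. -/
def optimum (n : ℕ) : Point n := fun _ => true

/-- Flipping the bit in position `v`. -/
def flipBit {n : ℕ} (x : Point n) (v : Fin n) : Point n := Function.update x v (!(x v))

open Classical in
/-- The search point obtained from `x` by proposing to flip bit `v` and applying the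
acceptance operator `op` for the objective function `f`. -/
noncomputable def movedPoint {n : ℕ} (f : Point n → ℝ) (op : Op) (x : Point n) (v : Fin n) :
    Point n :=
  match op with
  | Op.OI => if f x < f (flipBit x v) then flipBit x v else x
  | Op.OW => if f (flipBit x v) < f x then flipBit x v else x

open Classical in
/-- One-step transition probability of the search point under acceptance operator `op`:
a uniformly random bit is flipped and the move is accepted or rejected according to `op`. -/
noncomputable def moveProb {n : ℕ} (f : Point n → ℝ) (op : Op) (x x' : Point n) : ℝ≥0∞ :=
  ((Finset.univ.filter fun v => movedPoint f op x v = x').card : ℝ≥0∞) / n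

/-- Transition probabilities of the two-state Markov chain on the acceptance operators. -/
noncomputable def switchProb (p q : ℝ) : Op → Op → ℝ≥0∞
  | Op.OI, Op.OI => ENNReal.ofReal (1 - p)
  | Op.OI, Op.OW => ENNReal.ofReal p
  | Op.OW, Op.OI => ENNReal.ofReal q
  | Op.OW, Op.OW => ENNReal.ofReal (1 - q)

/-- One-step transition probabilities of the MMAHH on the state space
`Point n × Op`: the search point moves according to the current acceptance operator, and,
independently, the operator switches according to the two-state Markov chain. -/
noncomputable def mmahhTrans {n : ℕ} (f : Point n → ℝ) (p q : ℝ) :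
    Point n × Op → Point n × Op → ℝ≥0∞ :=
  fun s s' => moveProb f s.2 s.1 s'.1 * switchProb p q s.2 s'.2

/-- `X` is (a version of) the MMAHH Markov chain with objective function `f` and switching
probabilities `p` and `q`, under the measure `μ`: each `X t` is measurable, and conditionally
on any history, the next state is distributed according to `mmahhTrans`. -/
def IsMMAHH {n : ℕ} {Ω : Type*} [MeasurableSpace Ω] (μ : Measure Ω)
    (X : ℕ → Ω → Point n × Op) (f : Point n → ℝ) (p q : ℝ) : Prop :=
  (∀ t, Measurable (X t)) ∧
  ∀ (t : ℕ) (σ : ℕ → Point n × Op) (s' : Point n × Op),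
    μ {ω | (∀ i ≤ t, X i ω = σ i) ∧ X (t + 1) ω = s'}
      = μ {ω | ∀ i ≤ t, X i ω = σ i} * mmahhTrans f p q (σ t) s'

/-- The runtime: the first hitting time of the global optimum, as an extended natural number
(`⊤` if the optimum is never reached). -/
noncomputable def hitTime {n : ℕ} {Ω : Type*} (X : ℕ → Ω → Point n × Op) (ω : Ω) : ℕ∞ :=
  ⨅ t ∈ {t : ℕ | (X t ω).1 = optimum n}, (t : ℕ∞)

/-- The `k`-th switching time between the two acceptance operators (with junk value given by
`Nat.sInf ∅ = 0` on the probability-zero event that no further switch occurs). -/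
noncomputable def switchTime {n : ℕ} {Ω : Type*} (X : ℕ → Ω → Point n × Op) : ℕ → Ω → ℕ
  | 0, _ => 0
  | k + 1, ω =>
      sInf {t : ℕ | switchTime X k ω ≤ t ∧ (X t ω).2 ≠ (X (switchTime X k ω) ω).2}

/-- The Jump benchmark with gap parameter `m`. -/
noncomputable def Jump (n m : ℕ) (x : Point n) : ℝ :=
  if ones x ≤ n - m ∨ ones x = n then (m : ℝ) + (ones x : ℝ) else (n : ℝ) - (ones x : ℝ)

instance instDiscreteOp : DiscreteMeasurableSpace Op := ⟨fun _ => trivial⟩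

instance instFintypeOp : Fintype Op := ⟨{Op.OI, Op.OW}, fun x => by cases x <;> simp⟩

theorem sum_Op {M : Type*} [AddCommMonoid M] (F : Op → M) : ∑ o, F o = F Op.OI + F Op.OW := by
  have : (Finset.univ : Finset Op) = {Op.OI, Op.OW} := rfl
  rw [this, Finset.sum_pair (by decide)]

section Markov

variable {n : ℕ} {Ω : Type} [MeasurableSpace Ω] {μ : Measure Ω} {X : ℕ → Ω → Point n × Op}
  {f : Point n → ℝ} {p q : ℝ}

/-- the optimum has not been hit up to time `t` -/
def notHit (X : ℕ → Ω → Point n × Op) (t : ℕ) : Set Ω := {ω | ∀ i ≤ t, (X i ω).1 ≠ optimum n}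

theorem hitTime_le_tsum (ω : Ω) :
    (hitTime X ω : ℝ≥0∞) ≤ ∑' t, (notHit X t).indicator (fun _ => (1 : ℝ≥0∞)) ω := by
  classical
  by_cases h : ∃ t, (X t ω).1 = optimum n
  · have h1 : hitTime X ω ≤ (Nat.find h : ℕ∞) := by
      unfold hitTime
      exact iInf₂_le (Nat.find h) (Nat.find_spec h)
    have h2 : (hitTime X ω : ℝ≥0∞) ≤ ((Nat.find h : ℕ) : ℝ≥0∞) := by
      have := ENat.toENNReal_mono h1
      simpa using this
    refine h2.trans ?_
    refine le_trans ?_ (ENNReal.sum_le_tsum (Finset.range (Nat.find h)))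
    rw [Finset.sum_congr rfl (g := fun _ => (1 : ℝ≥0∞))]
    · simp
    · intro t ht
      rw [Set.indicator_of_mem]
      intro i hi
      exact Nat.find_min h (lt_of_le_of_lt hi (Finset.mem_range.1 ht))
  · push Not at h
    have : ∀ t, (notHit X t).indicator (fun _ => (1 : ℝ≥0∞)) ω = 1 := by
      intro t
      rw [Set.indicator_of_mem]
      intro i _
      exact h i
    simp [this]

theorem measurableSet_notHit (hX : ∀ t, Measurable (X t)) (t : ℕ) : MeasurableSet (notHit X t) := by
  have : notHit X t = ⋂ i ∈ Set.Iic t, (X i) ⁻¹' {s | s.1 ≠ optimum n} := by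
    ext ω; simp [notHit]
  rw [this]
  exact MeasurableSet.biInter (Set.to_countable _) fun i _ => hX i (Set.toFinite _).measurableSet

theorem markov_step (hM : IsMMAHH μ X f p q) (t : ℕ) (s' : Point n × Op) :
    μ (notHit X t ∩ X (t + 1) ⁻¹' {s'}) ≤
      ∑ s, μ (notHit X t ∩ X t ⁻¹' {s}) * mmahhTrans f p q s s' := by
  classical
  obtain ⟨hX, hP⟩ := hM
  let F : Ω → (Fin (t + 1) → Point n × Op) := fun ω i => X i ω
  have hF : Measurable F := measurable_pi_lambda _ fun i => hX i
  let ext : (Fin (t + 1) → Point n × Op) → ℕ → Point n × Op :=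
    fun σ i => if h : i < t + 1 then σ ⟨i, h⟩ else σ 0
  have hext : ∀ σ ω, (∀ i ≤ t, X i ω = ext σ i) ↔ F ω = σ := by
    intro σ ω
    constructor
    · intro h
      funext i
      have := h i (Nat.lt_succ_iff.1 i.2)
      simpa [F, ext, Nat.lt_succ_iff.1 i.2] using this
    · rintro rfl i hi
      simp only [F, ext, dif_pos (Nat.lt_succ_iff.2 hi)]
  let good : Finset (Fin (t + 1) → Point n × Op) :=
    Finset.univ.filter fun σ => ∀ i, (σ i).1 ≠ optimum n
  have hgood : ∀ ω, ω ∈ notHit X t ↔ F ω ∈ good := by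
    intro ω
    simp only [notHit, Set.mem_ofPred_eq, good, Finset.mem_filter, Finset.mem_univ, true_and, F]
    constructor
    · intro h i
      exact h i (Nat.lt_succ_iff.1 i.2)
    · intro h i hi
      exact h ⟨i, Nat.lt_succ_iff.2 hi⟩
  have hstep : ∀ σ, μ (F ⁻¹' {σ} ∩ X (t + 1) ⁻¹' {s'}) =
      μ (F ⁻¹' {σ}) * mmahhTrans f p q (σ (Fin.last t)) s' := by
    intro σ
    have := hP t (ext σ) s'
    simp only [hext] at this
    have h2 : ext σ t = σ (Fin.last t) := by simp [ext, Fin.last]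
    rw [h2] at this
    exact this
  calc μ (notHit X t ∩ X (t + 1) ⁻¹' {s'})
      ≤ μ (⋃ σ ∈ good, (F ⁻¹' {σ} ∩ X (t + 1) ⁻¹' {s'})) := by
        apply measure_mono
        rintro ω ⟨h1, h2⟩
        simp only [Set.mem_iUnion]
        exact ⟨F ω, (hgood ω).1 h1, rfl, h2⟩
    _ ≤ ∑ σ ∈ good, μ (F ⁻¹' {σ} ∩ X (t + 1) ⁻¹' {s'}) := measure_biUnion_finset_le _ _
    _ = ∑ σ ∈ good, μ (F ⁻¹' {σ}) * mmahhTrans f p q (σ (Fin.last t)) s' :=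
        Finset.sum_congr rfl fun σ _ => hstep σ
    _ = ∑ s, ∑ σ ∈ good with σ (Fin.last t) = s,
          μ (F ⁻¹' {σ}) * mmahhTrans f p q (σ (Fin.last t)) s' :=
        (Finset.sum_fiberwise good (fun σ => σ (Fin.last t)) _).symm
    _ = ∑ s, μ (notHit X t ∩ X t ⁻¹' {s}) * mmahhTrans f p q s s' := by
        refine Finset.sum_congr rfl fun s _ => ?_
        rw [Finset.sum_congr rfl (g := fun σ => μ (F ⁻¹' {σ}) * mmahhTrans f p q s s')]
        · rw [← Finset.sum_mul, sum_measure_preimage_singleton]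
          · congr 2
            ext ω
            simp only [Set.mem_preimage, Finset.coe_filter, Set.mem_ofPred_eq, Set.mem_inter_iff,
              hgood, Set.mem_singleton_iff]
            simp [F]
          · intro σ _
            exact hF (measurableSet_singleton σ)
        · intro σ hσ
          rw [(Finset.mem_filter.1 hσ).2]

theorem lintegral_hitTime_le [IsProbabilityMeasure μ] (hM : IsMMAHH μ X f p q)
    (h : Point n × Op → ℝ≥0∞) (M : ℝ≥0∞) (hle : ∀ s, h s ≤ M)
    (hd : ∀ s : Point n × Op, s.1 ≠ optimum n → ∑ s', mmahhTrans f p q s s' * h s' + 1 ≤ h s) :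
    ∫⁻ ω, (hitTime X ω : ℝ≥0∞) ∂μ ≤ M := by
  classical
  have hX := hM.1
  let N : ℕ → Point n × Op → ℝ≥0∞ := fun t s => μ (notHit X t ∩ X t ⁻¹' {s})
  let A : ℕ → ℝ≥0∞ := fun t => ∑ s, N t s * h s
  have hsum : ∀ t, ∑ s, N t s = μ (notHit X t) := by
    intro t
    have := sum_measure_preimage_singleton (μ := μ.restrict (notHit X t)) (f := X t)
      (Finset.univ) (fun s _ => hX t (measurableSet_singleton s))
    simp only [Finset.coe_univ, Set.preimage_univ, Measure.restrict_apply_univ] at this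
    rw [← this]
    refine Finset.sum_congr rfl fun s _ => ?_
    rw [Measure.restrict_apply (hX t (measurableSet_singleton s)), Set.inter_comm]
  have hzero : ∀ t s, s.1 = optimum n → N t s = 0 := by
    intro t s hs
    have : notHit X t ∩ X t ⁻¹' {s} = ∅ := by
      ext ω
      simp only [Set.mem_inter_iff, Set.mem_preimage, Set.mem_singleton_iff, Set.mem_empty_iff_false,
        iff_false, not_and]
      intro h1 h2
      exact h1 t le_rfl (by rw [h2, hs])
    simp [N, this]
  have hrec : ∀ t, A (t + 1) + μ (notHit X t) ≤ A t := by
    intro t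
    have h1 : A (t + 1) ≤ ∑ s, N t s * ∑ s', mmahhTrans f p q s s' * h s' := by
      calc A (t + 1) ≤ ∑ s', (∑ s, N t s * mmahhTrans f p q s s') * h s' := by
            refine Finset.sum_le_sum fun s' _ => ?_
            gcongr
            refine le_trans (measure_mono ?_) (markov_step hM t s')
            rintro ω ⟨a, b⟩
            exact ⟨fun i hi => a i (Nat.le_succ_of_le hi), b⟩
        _ = ∑ s, N t s * ∑ s', mmahhTrans f p q s s' * h s' := by
            simp_rw [Finset.sum_mul, Finset.mul_sum]
            rw [Finset.sum_comm]
            simp_rw [mul_assoc]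
    calc A (t + 1) + μ (notHit X t)
        ≤ ∑ s, N t s * ∑ s', mmahhTrans f p q s s' * h s' + ∑ s, N t s := by
          rw [hsum]; gcongr
      _ = ∑ s, N t s * (∑ s', mmahhTrans f p q s s' * h s' + 1) := by
          rw [← Finset.sum_add_distrib]
          simp_rw [mul_add, mul_one]
      _ ≤ A t := by
          refine Finset.sum_le_sum fun s _ => ?_
          by_cases hs : s.1 = optimum n
          · rw [hzero t s hs]; simp
          · gcongr; exact hd s hs
  have hpart : ∀ T, ∑ t ∈ Finset.range T, μ (notHit X t) + A T ≤ A 0 := by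
    intro T
    induction T with
    | zero => simp
    | succ T ih =>
      rw [Finset.sum_range_succ]
      refine le_trans ?_ ih
      rw [add_assoc, add_comm (μ _)]
      gcongr
      exact hrec T
  have hA0 : A 0 ≤ M := by
    calc A 0 ≤ ∑ s, N 0 s * M := Finset.sum_le_sum fun s _ => by gcongr; exact hle s
      _ = μ (notHit X 0) * M := by rw [← Finset.sum_mul, hsum]
      _ ≤ 1 * M := by gcongr; exact prob_le_one
      _ = M := one_mul _
  calc ∫⁻ ω, (hitTime X ω : ℝ≥0∞) ∂μ
      ≤ ∫⁻ ω, ∑' t, (notHit X t).indicator (fun _ => (1 : ℝ≥0∞)) ω ∂μ :=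
        lintegral_mono fun ω => hitTime_le_tsum ω
    _ = ∑' t, μ (notHit X t) := by
        rw [lintegral_tsum]
        · refine tsum_congr fun t => ?_
          rw [lintegral_indicator (measurableSet_notHit hX t)]
          simp
        · intro t
          exact (measurable_const.indicator (measurableSet_notHit hX t)).aemeasurable
    _ ≤ M := by
        refine ENNReal.tsum_le_of_sum_range_le fun T => ?_
        exact le_trans (le_trans le_self_add (hpart T)) hA0

end Markov

section Layers

/-- number of zero-bits -/
def zeros {n : ℕ} (x : Point n) : ℕ := (Finset.univ.filter fun i => x i = false).card

theorem ones_add_zeros {n : ℕ} (x : Point n) : ones x + zeros x = n := by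
  have := Finset.card_filter_add_card_filter_not (s := (Finset.univ : Finset (Fin n)))
    (fun i => x i = true)
  simpa [ones, zeros] using this

theorem zeros_eq_zero {n : ℕ} (x : Point n) : zeros x = 0 ↔ x = optimum n := by
  simp only [zeros, Finset.card_eq_zero, Finset.filter_eq_empty_iff]
  constructor
  · intro h; funext i; simpa [optimum] using h (Finset.mem_univ i)
  · rintro rfl i _; simp [optimum]

theorem zeros_flip_true {n : ℕ} (x : Point n) (v : Fin n) (hv : x v = true) :
    zeros (flipBit x v) = zeros x + 1 := by
  classical
  have : (Finset.univ.filter fun i => flipBit x v i = false) =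
      insert v (Finset.univ.filter fun i => x i = false) := by
    ext i
    simp only [Finset.mem_filter, Finset.mem_insert, Finset.mem_univ, true_and]
    by_cases h : i = v
    · subst h; simp [flipBit, hv]
    · simp [flipBit, h]
  rw [zeros, this, Finset.card_insert_of_notMem (by simp [hv]), zeros]

theorem flip_flip {n : ℕ} (x : Point n) (v : Fin n) : flipBit (flipBit x v) v = x := by
  funext i
  by_cases h : i = v
  · subst h; simp [flipBit]
  · simp [flipBit, h]

theorem zeros_flip_false {n : ℕ} (x : Point n) (v : Fin n) (hv : x v = false) :
    zeros (flipBit x v) + 1 = zeros x := by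
  have := zeros_flip_true (flipBit x v) v (by simp [flipBit, hv])
  rw [flip_flip] at this
  exact this.symm

/-- Jump by number of zeros -/
noncomputable def JZ (n m k : ℕ) : ℝ := if m ≤ k ∨ k = 0 then (m : ℝ) + (n - k) else k

theorem Jump_eq {n m : ℕ} (hm : m ≤ n) (x : Point n) : Jump n m x = JZ n m (zeros x) := by
  have h := ones_add_zeros x
  have hr : (ones x : ℝ) = n - zeros x := by
    rw [eq_sub_iff_add_eq]; exact_mod_cast h
  unfold Jump JZ
  have : (ones x ≤ n - m ∨ ones x = n) ↔ (m ≤ zeros x ∨ zeros x = 0) := by omega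
  simp only [this, hr]
  split_ifs <;> ring

/-- layer after proposing to flip a zero -/
def dn (m : ℕ) : Op → ℕ → ℕ
  | Op.OI, k => if m < k ∨ k = 1 then k - 1 else k
  | Op.OW, k => if 2 ≤ k ∧ k ≤ m then k - 1 else k

/-- layer after proposing to flip a one -/
def up (m : ℕ) : Op → ℕ → ℕ
  | Op.OI, k => if k < m then k + 1 else k
  | Op.OW, k => if m ≤ k then k + 1 else k

theorem JZ_lt {n m k : ℕ} (hm : 2 ≤ m) (hmn : 2 * m ≤ n) (hk : k + 1 ≤ n) :
    JZ n m (k + 1) < JZ n m k ↔ m < k + 1 ∨ k + 1 = 1 := by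
  have hmn' : (2 : ℝ) * m ≤ n := by exact_mod_cast hmn
  have hk' : (k : ℝ) + 1 ≤ n := by exact_mod_cast hk
  have hm' : (2 : ℝ) ≤ m := by exact_mod_cast hm
  unfold JZ
  rcases Nat.eq_zero_or_pos k with rfl | hk0
  · rw [if_neg (by omega), if_pos (by simp)]
    simp; linarith
  rcases lt_trichotomy (k + 1) m with h | h | h
  · rw [if_neg (by omega), if_neg (by omega)]
    push_cast
    constructor
    · intro h; linarith
    · intro h; omega
  · rw [if_pos (by omega), if_neg (by omega)]
    subst h
    push_cast at *
    constructor
    · intro h; linarith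
    · intro h; omega
  · rw [if_pos (by omega), if_pos (by omega)]
    push_cast
    constructor
    · intro _; left; exact h
    · intro _; linarith

theorem JZ_gt {n m k : ℕ} (hm : 2 ≤ m) (hmn : 2 * m ≤ n) (hk : k + 1 ≤ n) :
    JZ n m k < JZ n m (k + 1) ↔ 1 ≤ k ∧ k + 1 ≤ m := by
  have hmn' : (2 : ℝ) * m ≤ n := by exact_mod_cast hmn
  have hk' : (k : ℝ) + 1 ≤ n := by exact_mod_cast hk
  have hm' : (2 : ℝ) ≤ m := by exact_mod_cast hm
  unfold JZ
  rcases Nat.eq_zero_or_pos k with rfl | hk0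
  · rw [if_pos (by simp), if_neg (by omega)]
    simp; linarith
  rcases lt_trichotomy (k + 1) m with h | h | h
  · rw [if_neg (by omega), if_neg (by omega)]
    push_cast
    constructor
    · intro _; omega
    · intro _; linarith
  · rw [if_neg (by omega), if_pos (by omega)]
    subst h
    push_cast at *
    constructor
    · intro h; omega
    · intro h; linarith
  · rw [if_pos (by omega), if_pos (by omega)]
    push_cast
    constructor
    · intro _; linarith
    · intro _; omega

theorem zeros_moved_false {n m : ℕ} (hm : 2 ≤ m) (hmn : 2 * m ≤ n) (op : Op) (x : Point n)
    (v : Fin n) (hv : x v = false) :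
    zeros (movedPoint (Jump n m) op x v) = dn m op (zeros x) := by
  have h1 := zeros_flip_false x v hv
  have h2 := ones_add_zeros x
  cases op
  · simp only [movedPoint, Jump_eq (show m ≤ n by omega), dn]
    rw [← h1]
    simp only [JZ_lt hm hmn (show zeros (flipBit x v) + 1 ≤ n by omega)]
    split_ifs <;> omega
  · simp only [movedPoint, Jump_eq (show m ≤ n by omega), dn]
    rw [← h1]
    simp only [JZ_gt hm hmn (show zeros (flipBit x v) + 1 ≤ n by omega)]
    split_ifs <;> omega

theorem zeros_moved_true {n m : ℕ} (hm : 2 ≤ m) (hmn : 2 * m ≤ n) (op : Op) (x : Point n)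
    (v : Fin n) (hv : x v = true) (hx : 1 ≤ zeros x) :
    zeros (movedPoint (Jump n m) op x v) = up m op (zeros x) := by
  have h1 := zeros_flip_true x v hv
  have h2 := ones_add_zeros x
  have h3 := ones_add_zeros (flipBit x v)
  cases op
  · simp only [movedPoint, Jump_eq (show m ≤ n by omega), up]
    rw [h1]
    simp only [JZ_gt hm hmn (show zeros x + 1 ≤ n by omega)]
    split_ifs <;> omega
  · simp only [movedPoint, Jump_eq (show m ≤ n by omega), up]
    rw [h1]
    simp only [JZ_lt hm hmn (show zeros x + 1 ≤ n by omega)]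
    split_ifs <;> omega

/-- real switching probabilities -/
noncomputable def sw (p q : ℝ) : Op → Op → ℝ
  | Op.OI, Op.OI => 1 - p
  | Op.OI, Op.OW => p
  | Op.OW, Op.OI => q
  | Op.OW, Op.OW => 1 - q

theorem switchProb_eq (p q : ℝ) (o o' : Op) : switchProb p q o o' = ENNReal.ofReal (sw p q o o') := by
  cases o <;> cases o' <;> rfl

theorem sum_trans {n : ℕ} (hn : 0 < n) (f : Point n → ℝ) (p q : ℝ) (hp : 0 < p) (hp1 : p < 1)
    (hq : 0 < q) (hq1 : q < 1) (G : Point n × Op → ℝ) (hG : ∀ s, 0 ≤ G s) (s : Point n × Op) :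
    ∑ s', mmahhTrans f p q s s' * ENNReal.ofReal (G s') =
      ENNReal.ofReal ((∑ v, ∑ o, sw p q s.2 o * G (movedPoint f s.2 s.1 v, o)) / n) := by
  classical
  have hsw : ∀ o o', 0 ≤ sw p q o o' := by
    intro o o'; cases o <;> cases o' <;> simp [sw] <;> linarith
  have hn' : (0 : ℝ) < n := by exact_mod_cast hn
  rw [ENNReal.ofReal_div_of_pos hn', ENNReal.ofReal_sum_of_nonneg
    (fun v _ => Finset.sum_nonneg fun o _ => mul_nonneg (hsw _ _) (hG _)), ENNReal.ofReal_natCast]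
  rw [Fintype.sum_prod_type]
  have key : ∀ x' : Point n, ∑ o, mmahhTrans f p q s (x', o) * ENNReal.ofReal (G (x', o)) =
      (∑ v, if movedPoint f s.2 s.1 v = x' then
        ENNReal.ofReal (∑ o, sw p q s.2 o * G (x', o)) else 0) / n := by
    intro x'
    rw [← Finset.sum_filter, Finset.sum_const, nsmul_eq_mul,
      ENNReal.ofReal_sum_of_nonneg (fun o _ => mul_nonneg (hsw _ _) (hG _)), ENNReal.div_eq_inv_mul,
      Finset.mul_sum, Finset.mul_sum]
    refine Finset.sum_congr rfl fun o _ => ?_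
    rw [ENNReal.ofReal_mul (hsw _ _), ← switchProb_eq]
    simp only [mmahhTrans, moveProb, ENNReal.div_eq_inv_mul]
    ring
  simp_rw [key, ENNReal.div_eq_inv_mul, ← Finset.mul_sum]
  rw [Finset.sum_comm]
  congr 1
  refine Finset.sum_congr rfl fun v _ => ?_
  simp

/-- averaged value of a layer function after a move -/
noncomputable def av (n m : ℕ) (g : ℕ → Op → ℝ) (op : Op) (k : ℕ) (o : Op) : ℝ :=
  ((k : ℝ) * g (dn m op k) o + ((n : ℝ) - k) * g (up m op k) o) / n

theorem sum_moved {n m : ℕ} (hm : 2 ≤ m) (hmn : 2 * m ≤ n) (op : Op) (x : Point n)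
    (hx : 1 ≤ zeros x) (F : ℕ → ℝ) :
    ∑ v, F (zeros (movedPoint (Jump n m) op x v)) =
      (zeros x : ℝ) * F (dn m op (zeros x)) + ((n : ℝ) - zeros x) * F (up m op (zeros x)) := by
  classical
  have h2 := ones_add_zeros x
  have hr : (ones x : ℝ) = n - zeros x := by
    rw [eq_sub_iff_add_eq]; exact_mod_cast h2
  rw [← Finset.sum_filter_add_sum_filter_not Finset.univ (fun v => x v = false)]
  congr 1
  · rw [Finset.sum_congr rfl (g := fun _ => F (dn m op (zeros x)))]
    · simp [zeros]
    · intro v hv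
      rw [zeros_moved_false hm hmn op x v (Finset.mem_filter.1 hv).2]
  · rw [Finset.sum_congr rfl (g := fun _ => F (up m op (zeros x)))]
    · rw [Finset.sum_const, nsmul_eq_mul, ← hr]
      simp [ones]
    · intro v hv
      rw [zeros_moved_true hm hmn op x v (by simpa using (Finset.mem_filter.1 hv).2) hx]

theorem runtime_of_drift {n m : ℕ} (hm : 2 ≤ m) (hmn : 2 * m ≤ n) {p q : ℝ}
    (hp : 0 < p) (hp1 : p < 1) (hq : 0 < q) (hq1 : q < 1)
    (g : ℕ → Op → ℝ) (d : ℝ) (hd : 0 < d) (hg0 : ∀ k o, 0 ≤ g k o) (hg1 : ∀ k o, g k o ≤ 1)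
    (hI : ∀ k, 1 ≤ k → k ≤ n →
      g k Op.OI + d ≤ (1 - p) * av n m g Op.OI k Op.OI + p * av n m g Op.OI k Op.OW)
    (hW : ∀ k, 1 ≤ k → k ≤ n →
      g k Op.OW + d ≤ q * av n m g Op.OW k Op.OI + (1 - q) * av n m g Op.OW k Op.OW)
    {Ω : Type} [MeasurableSpace Ω] (μ : Measure Ω) (X : ℕ → Ω → Point n × Op)
    [IsProbabilityMeasure μ] (hM : IsMMAHH μ X (Jump n m) p q) :
    ∫⁻ ω, (hitTime X ω : ℝ≥0∞) ∂μ ≤ ENNReal.ofReal (1 / d) := by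
  have hn : 0 < n := by omega
  have hn' : (0 : ℝ) < n := by exact_mod_cast hn
  let G : Point n × Op → ℝ := fun s => (1 - g (zeros s.1) s.2) / d
  have hG : ∀ s, 0 ≤ G s := fun s => div_nonneg (by linarith [hg1 (zeros s.1) s.2]) hd.le
  refine lintegral_hitTime_le hM (fun s => ENNReal.ofReal (G s)) _ (fun s => ?_) ?_
  · apply ENNReal.ofReal_le_ofReal
    simp only [G]
    gcongr
    linarith [hg0 (zeros s.1) s.2]
  · rintro ⟨x, op⟩ hs
    have hx : 1 ≤ zeros x := Nat.one_le_iff_ne_zero.2 fun h => hs ((zeros_eq_zero x).1 h)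
    have hxn : zeros x ≤ n := by have := ones_add_zeros x; omega
    rw [sum_trans hn _ p q hp hp1 hq hq1 G hG, ← ENNReal.ofReal_one, ← ENNReal.ofReal_add]
    · apply ENNReal.ofReal_le_ofReal
      have := sum_moved hm hmn op x hx (fun k => ∑ o, sw p q op o * ((1 - g k o) / d))
      simp only [G]
      rw [this]
      simp only [sum_Op]
      have h1 : ∀ A B : ℝ, d * n * A + d * n ≤ n * (1 - B) → A + 1 ≤ (1 - B) / d := by
        intro A B h
        rw [le_div_iff₀ hd]
        have : (0:ℝ) ≤ n * ((1 - B) - (A + 1) * d) := by linarith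
        have := nonneg_of_mul_nonneg_right this hn'
        linarith
      apply h1
      cases op
      · have := mul_le_mul_of_nonneg_left (hI _ hx hxn) hn'.le
        simp only [sw, av] at *
        field_simp at *
        nlinarith
      · have := mul_le_mul_of_nonneg_left (hW _ hx hxn) hn'.le
        simp only [sw, av] at *
        field_simp at *
        nlinarith
    · apply div_nonneg _ hn'.le
      refine Finset.sum_nonneg fun v _ => Finset.sum_nonneg fun o _ => mul_nonneg ?_ (hG _)
      cases op <;> cases o <;> simp [sw] <;> linarith
    · norm_num

end Layers

section Small

theorem av_ge {n m : ℕ} (hn : 0 < n) (g : ℕ → Op → ℝ) (hg0 : ∀ k o, 0 ≤ g k o) (op o : Op) (k : ℕ)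
    (hk : k ≤ n) : (k : ℝ) / n * g (dn m op k) o ≤ av n m g op k o := by
  have hn' : (0 : ℝ) < n := by exact_mod_cast hn
  have hk' : (k : ℝ) ≤ n := by exact_mod_cast hk
  unfold av
  rw [add_div, div_mul_eq_mul_div]
  have : 0 ≤ ((n : ℝ) - k) * g (up m op k) o / n :=
    div_nonneg (mul_nonneg (by linarith) (hg0 _ _)) hn'.le
  linarith

theorem av_nonneg {n m : ℕ} (hn : 0 < n) (g : ℕ → Op → ℝ) (hg0 : ∀ k o, 0 ≤ g k o) (op o : Op)
    (k : ℕ) (hk : k ≤ n) : 0 ≤ av n m g op k o :=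
  le_trans (mul_nonneg (by positivity) (hg0 _ _)) (av_ge hn g hg0 op o k hk)

/-- rank function for the small case -/
def rk (m k : ℕ) : Op → ℕ
  | Op.OI => if k = 1 then 1 else 2 * k
  | Op.OW => if k = 1 then 2 else if k ≤ m then 2 * k - 1 else 2 * k + 1

theorem runtime_small (n : ℕ) (hn : 4 ≤ n) (p0 : ℝ) (hp0 : 0 < p0) :
    ∃ M : ℝ, 0 ≤ M ∧ ∀ m : ℕ, 2 ≤ m → 2 * m ≤ n → ∀ p q : ℝ, 0 < p → p < 1 → 0 < q → q < 1 →
      p0 ≤ p → p0 ≤ q → ∀ (Ω : Type) [MeasurableSpace Ω] (μ : Measure Ω)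
        (X : ℕ → Ω → Point n × Op), IsProbabilityMeasure μ → IsMMAHH μ X (Jump n m) p q →
        ∫⁻ ω, (hitTime X ω : ℝ≥0∞) ∂μ ≤ ENNReal.ofReal M := by
  have hn' : (4 : ℝ) ≤ n := by exact_mod_cast hn
  set r : ℝ := p0 / (2 * n) with hr
  have hr0 : 0 < r := by positivity
  refine ⟨1 / r ^ (2 * n + 1), by positivity, ?_⟩
  intro m hm hmn p q hp hp1 hq hq1 hpp hqq Ω _ μ X hμ hM
  have hr1 : r ≤ 1 := by
    rw [hr, div_le_one (by positivity)]; linarith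
  have key : ∀ (k e l : ℕ) (s : ℝ), 1 ≤ k → p0 ≤ s → e + 1 ≤ l → l ≤ 2 * n + 1 →
      r ^ l + r ^ (2 * n + 1) ≤ s * ((k : ℝ) / n * r ^ e) := by
    intro k e l s hk hs he hl
    have hk' : (1 : ℝ) ≤ k := by exact_mod_cast hk
    have hs0 : 0 ≤ s := hp0.le.trans hs
    have h1 : r ^ l ≤ r ^ (e + 1) := pow_le_pow_of_le_one hr0.le hr1 he
    have h2 : r ^ (2 * n + 1) ≤ r ^ (e + 1) := pow_le_pow_of_le_one hr0.le hr1 (he.trans hl)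
    have h3 : p0 * (1 / n * r ^ e) ≤ s * ((k : ℝ) / n * r ^ e) := by
      gcongr
    have h4 : p0 * (1 / n * r ^ e) = 2 * r ^ (e + 1) := by
      rw [pow_succ, hr]; field_simp
    linarith
  have hg0 : ∀ k o, 0 ≤ (fun k o => r ^ rk m k o : ℕ → Op → ℝ) k o := fun k o => by positivity
  refine runtime_of_drift hm hmn hp hp1 hq hq1 (fun k o => r ^ rk m k o) _ (by positivity) hg0
    (fun k o => pow_le_one₀ hr0.le hr1) ?_ ?_ μ X hM
  · intro k hk hkn
    have h1 := av_ge (m := m) (show 0 < n by omega) _ hg0 Op.OI Op.OW k hkn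
    have h2 := av_nonneg (m := m) (show 0 < n by omega) _ hg0 Op.OI Op.OI k hkn
    have h3 := key k (rk m (dn m Op.OI k) Op.OW) (rk m k Op.OI) p hk hpp
      (by simp only [rk, dn]; split_ifs <;> omega) (by simp only [rk]; split_ifs <;> omega)
    have h4 := mul_le_mul_of_nonneg_left h1 hp.le
    have h5 := mul_nonneg (by linarith : 0 ≤ 1 - p) h2
    exact h3.trans (h4.trans (by linarith))
  · intro k hk hkn
    have h1 := av_ge (m := m) (show 0 < n by omega) _ hg0 Op.OW Op.OI k hkn
    have h2 := av_nonneg (m := m) (show 0 < n by omega) _ hg0 Op.OW Op.OW k hkn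
    have h3 := key k (rk m (dn m Op.OW k) Op.OI) (rk m k Op.OW) q hk hqq
      (by simp only [rk, dn]; split_ifs <;> omega) (by simp only [rk]; split_ifs <;> omega)
    have h4 := mul_le_mul_of_nonneg_left h1 hq.le
    have h5 := mul_nonneg (by linarith : 0 ≤ 1 - q) h2
    exact h3.trans (h4.trans (by linarith))

end Small

section Large

/-- the potential for the large case -/
noncomputable def pot (n m : ℕ) (θ ε : ℝ) (w : ℕ → ℝ) (k : ℕ) : Op → ℝ
  | Op.OI => if k = 0 then 1 else if k = 1 then 1 / (2 * n) else
      if k < m then θ / 32 * ε * w m * ((n - m + k) / n) else θ / 32 * ε * w k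
  | Op.OW => if k = 0 then 1 else if k < m then w k / (4 * n) else
      if k = m then ε * θ / 16 else 0

set_option maxHeartbeats 4000000 in
theorem pot_drift {n m : ℕ} (hm : 2 ≤ m) (hmn : 2 * m ≤ n) {a b L p q θ : ℝ} (w : ℕ → ℝ)
    (ha : 0 < a) (hL1 : 1 ≤ L) (hLb : 8 * b ≤ L)
    (hp : 0 < p) (hq : 0 < q)
    (hpa : a / (n * L) ≤ p) (hpb : p ≤ b / (n * L)) (hqa : a / (n * L) ≤ q) (hqb : q ≤ b / (n * L))
    (hθ : 0 < θ) (hw0 : ∀ k, 0 ≤ w k) (hw1 : ∀ k, w k ≤ 1) (hwθ : ∀ k ≤ n, θ ≤ w k)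
    (hw : ∀ k : ℕ, (2 * b + 2) / L * w (k + 1) ≤ ((k + 1 : ℕ) : ℝ) * (w k - w (k + 1)))
    (g : ℕ → Op → ℝ) (hg : g = pot n m θ (m / n ^ 2) w) (d : ℝ)
    (hd : d = min 1 a * θ ^ 2 / 256 * (m / n ^ 2) / (n * L)) :
    (∀ k o, 0 ≤ g k o) ∧ (∀ k o, g k o ≤ 1) ∧
    (∀ k, 1 ≤ k → k ≤ n →
      g k Op.OI + d ≤ (1 - p) * av n m g Op.OI k Op.OI + p * av n m g Op.OI k Op.OW) ∧
    (∀ k, 1 ≤ k → k ≤ n →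
      g k Op.OW + d ≤ q * av n m g Op.OW k Op.OI + (1 - q) * av n m g Op.OW k Op.OW) := by
  have hn4 : 4 ≤ n := by omega
  have hn0 : 0 < n := by omega
  have hn : (4 : ℝ) ≤ n := by exact_mod_cast hn4
  have hnp : (0 : ℝ) < n := by linarith
  have hm2 : (2 : ℝ) ≤ m := by exact_mod_cast hm
  have hmn2 : 2 * (m : ℝ) ≤ n := by exact_mod_cast hmn
  have hL0 : 0 < L := by linarith
  -- abbreviations
  set i : ℝ := 1 / n with hi
  set e : ℝ := 1 / (n * L) with he
  set ε : ℝ := m / (n : ℝ) ^ 2 with hε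
  have hni : (n : ℝ) * i = 1 := by rw [hi]; field_simp
  have hi0 : 0 < i := by positivity
  have he0 : 0 < e := by positivity
  have hε0 : 0 < ε := by positivity
  have hi4 : i ≤ 1 / 4 := by
    rw [hi]; exact one_div_le_one_div_of_le (by norm_num) hn
  have heL : e * L = i := by rw [he, hi]; field_simp
  have hei : e ≤ i := by rw [← heL]; exact le_mul_of_one_le_right he0.le hL1
  have hεm : ε = m * i * i := by rw [hε, hi]; field_simp
  have hmi : (m : ℝ) * i ≤ 1 / 2 := by
    have := mul_le_mul_of_nonneg_right hmn2 hi0.le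
    linarith
  have hεi : ε ≤ i / 2 := by
    rw [hεm]
    have := mul_le_mul_of_nonneg_right hmi hi0.le
    linarith
  have hbe : 8 * (b * e) ≤ i := by
    rw [← heL]
    have := mul_le_mul_of_nonneg_left hLb he0.le
    linarith
  have hpa' : a * e ≤ p := by rw [he, mul_one_div]; exact hpa
  have hqa' : a * e ≤ q := by rw [he, mul_one_div]; exact hqa
  have hpb' : p ≤ b * e := by rw [he, mul_one_div]; exact hpb
  have hqb' : q ≤ b * e := by rw [he, mul_one_div]; exact hqb
  have hp2 : p ≤ 1 / 2 := by linarith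
  have hq2 : q ≤ 1 / 2 := by linarith
  have hθ1 : θ ≤ 1 := (hwθ 0 (by omega)).trans (hw1 0)
  have hγ0 : 0 < θ / 32 * ε := by positivity
  set t : ℝ := ε * e with ht
  have ht0 : 0 < t := by positivity
  set c : ℝ := min 1 a * θ ^ 2 / 256 with hc
  have hmin0 : 0 < min 1 a := lt_min one_pos ha
  have hd' : d = c * t := by rw [hd, ht, he]; ring
  have hθθ : θ ^ 2 ≤ θ := by rw [sq]; exact mul_le_of_le_one_left hθ.le hθ1
  have hcθ : c ≤ θ ^ 2 / 256 := by
    have h1 := mul_le_mul_of_nonneg_right (min_le_left 1 a) (sq_nonneg θ)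
    rw [hc]; linarith
  have hca : c ≤ a * θ ^ 2 / 256 := by
    have h1 := mul_le_mul_of_nonneg_right (min_le_right 1 a) (sq_nonneg θ)
    rw [hc]; linarith
  have hdθ : d ≤ θ ^ 2 / 256 * t := by rw [hd']; gcongr
  have hda : d ≤ a * θ ^ 2 / 256 * t := by rw [hd']; gcongr
  have hg0 : ∀ k o, 0 ≤ g k o := by
    intro k o
    rw [hg]
    cases o
    · simp only [pot]
      have := hw0 m
      have := hw0 k
      have : 0 ≤ (n : ℝ) - m + k := by
        have : (0 : ℝ) ≤ k := by positivity
        linarith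
      split_ifs <;> positivity
    · simp only [pot]
      have := hw0 k
      split_ifs <;> positivity
  have hγ1 : θ / 32 * ε ≤ 1 := by
    have : θ / 32 ≤ 1 := by linarith
    have : ε ≤ 1 := by linarith
    exact mul_le_one₀ ‹θ / 32 ≤ 1› hε0.le this
  have hg1 : ∀ k o, g k o ≤ 1 := by
    intro k o
    rw [hg]
    cases o
    · simp only [pot]
      split_ifs with h1 h2 h3
      · exact le_rfl
      · rw [div_le_one (by positivity)]; linarith
      · have h4 : ((n : ℝ) - m + k) / n ≤ 1 := by
          rw [div_le_one hnp]
          have : (k : ℝ) ≤ m := by exact_mod_cast h3.le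
          linarith
        have h6 : θ / 32 * ε * w m ≤ 1 := mul_le_one₀ hγ1 (hw0 m) (hw1 m)
        have h7 : 0 ≤ θ / 32 * ε * w m := mul_nonneg hγ0.le (hw0 m)
        exact (mul_le_of_le_one_right h7 h4).trans h6
      · exact mul_le_one₀ hγ1 (hw0 k) (hw1 k)
    · simp only [pot]
      split_ifs with h1 h2 h3
      · exact le_rfl
      · rw [div_le_one (by positivity)]; linarith [hw1 k]
      · have h4 : ε ≤ 1 := by linarith
        have := mul_le_one₀ h4 hθ.le hθ1
        linarith
      · norm_num
  -- values
  have gI1 : g 1 Op.OI = i / 2 := by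
    rw [hg]; simp [pot, hi]; ring
  have g0 : ∀ o, g 0 o = 1 := by
    intro o; rw [hg]; cases o <;> simp [pot]
  have gIlow : ∀ k, 2 ≤ k → k ≤ m → g k Op.OI = θ / 32 * ε * w m * ((n - m + k) / n) := by
    intro k h1 h2
    rw [hg]
    simp only [pot]
    rw [if_neg (by omega), if_neg (by omega)]
    split_ifs with h
    · rfl
    · have : k = m := by omega
      subst this
      field_simp
      ring
  have gIhigh : ∀ k, m ≤ k → g k Op.OI = θ / 32 * ε * w k := by
    intro k h1
    rw [hg]
    simp only [pot]
    rw [if_neg (by omega), if_neg (by omega), if_neg (by omega)]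
  have gWlow : ∀ k, 1 ≤ k → k < m → g k Op.OW = w k * i / 4 := by
    intro k h1 h2
    rw [hg]
    simp only [pot]
    rw [if_neg (by omega), if_pos h2, hi]
    field_simp
  have gWm : g m Op.OW = ε * θ / 16 := by
    rw [hg]
    simp only [pot]
    rw [if_neg (by omega), if_neg (by omega)]
    simp
  have gWhigh : ∀ k, m < k → g k Op.OW = 0 := by
    intro k h
    rw [hg]
    simp only [pot]
    rw [if_neg (by omega), if_neg (by omega), if_neg (by omega)]
  have av_eq : ∀ op k o, av n m g op k o =
      (k * i) * g (dn m op k) o + (1 - k * i) * g (up m op k) o := by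
    intro op k o
    unfold av
    rw [hi]
    field_simp
  -- gain of w
  have hwgain : ∀ k : ℕ, 1 ≤ k → (2 * b + 2) * e * w k ≤ (k * i) * (w (k - 1) - w k) := by
    intro k hk
    obtain ⟨j, rfl⟩ : ∃ j, k = j + 1 := ⟨k - 1, by omega⟩
    have h := mul_le_mul_of_nonneg_right (hw j) hi0.le
    have h2 : (2 * b + 2) / L * w (j + 1) * i = (2 * b + 2) * e * w (j + 1) := by
      rw [← heL]; field_simp
    rw [h2] at h
    simp only [Nat.add_sub_cancel]
    linarith
  have hb0 : 0 ≤ b * e := by linarith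
  -- net gain of w under killing
  have hnet : ∀ (s : ℝ) (k : ℕ), 0 < s → s ≤ b * e → s ≤ 1 / 2 → 1 ≤ k → k ≤ n →
      w k + θ * e ≤ (1 - s) * ((k * i) * w (k - 1) + (1 - k * i) * w k) := by
    intro s k hs hsb hs2 hk hkn
    have h1 := hwgain k hk
    have h2 := hwθ k hkn
    have h3 := hw0 k
    have h4 : (1 / 2) * ((2 * b + 2) * e * w k) ≤ (1 - s) * ((k * i) * (w (k - 1) - w k)) := by
      apply mul_le_mul (by linarith) h1
      · have : (2 * b + 2) * e * w k = 2 * (b * e) * w k + 2 * e * w k := by ring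
        rw [this]; positivity
      · linarith
    have h5 : s * w k ≤ b * e * w k := by gcongr
    have h6 : θ * e ≤ w k * e := by gcongr
    linarith
  refine ⟨hg0, hg1, ?_, ?_⟩
  · intro k hk hkn
    have hki : (k : ℝ) * i ≤ 1 := by
      rw [← hni]; have : (k : ℝ) ≤ n := by exact_mod_cast hkn
      gcongr
    have hW0 := av_nonneg (m := m) hn0 g hg0 Op.OI Op.OW k hkn
    have hI0 := av_nonneg (m := m) hn0 g hg0 Op.OI Op.OI k hkn
    rcases (show k = 1 ∨ (2 ≤ k ∧ k < m) ∨ k = m ∨ m < k by omega) with h | ⟨h1, h2⟩ | h | h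
    · subst h
      have e1 : i ≤ av n m g Op.OI 1 Op.OI := by
        have := av_ge (m := m) hn0 g hg0 Op.OI Op.OI 1 hkn
        simp only [dn, or_true, if_true, Nat.sub_self, g0] at this
        simpa [hi] using this
      have e2 : i ≤ av n m g Op.OI 1 Op.OW := by
        have := av_ge (m := m) hn0 g hg0 Op.OI Op.OW 1 hkn
        simp only [dn, or_true, if_true, Nat.sub_self, g0] at this
        simpa [hi] using this
      rw [gI1]
      have h1 : (1 - p) * i ≤ (1 - p) * av n m g Op.OI 1 Op.OI :=
        mul_le_mul_of_nonneg_left e1 (by linarith)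
      have h2 : p * i ≤ p * av n m g Op.OI 1 Op.OW := mul_le_mul_of_nonneg_left e2 hp.le
      have h3 : t ≤ i / 2 := by
        rw [ht]
        exact (mul_le_of_le_one_right hε0.le (by linarith)).trans hεi
      have h4 : θ ^ 2 / 256 * t ≤ 1 * t := by gcongr; linarith
      linarith
    · have e1 : av n m g Op.OI k Op.OI = g k Op.OI + (1 - k * i) * (θ / 32 * ε * w m * i) := by
        rw [av_eq]
        simp only [dn, up]
        rw [if_neg (by omega), if_pos h2, gIlow k h1 h2.le, gIlow (k + 1) (by omega) h2]
        rw [hi]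
        push_cast
        field_simp
        ring
      set W : ℝ := θ / 32 * ε * w m with hWd
      have hW : 0 ≤ W := mul_nonneg hγ0.le (hw0 m)
      have hu : g k Op.OI ≤ W := by
        rw [gIlow k h1 h2.le]
        have h4 : ((n : ℝ) - m + k) / n ≤ 1 := by
          rw [div_le_one hnp]
          have : (k : ℝ) ≤ m := by exact_mod_cast h2.le
          linarith
        exact mul_le_of_le_one_right hW h4
      have hk2 : 1 / 2 ≤ 1 - (k : ℝ) * i := by
        have : (k : ℝ) ≤ m := by exact_mod_cast h2.le
        have := mul_le_mul_of_nonneg_right this hi0.le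
        linarith
      have hWi : 0 ≤ W * i := by positivity
      have h3 : (1 / 4) * (W * i) ≤ (1 - p) * (1 - k * i) * (W * i) := by
        gcongr
        have := mul_le_mul (show 1 / 2 ≤ 1 - p by linarith) hk2 (by norm_num) (by linarith)
        linarith
      have h4 : p * g k Op.OI ≤ i / 8 * W := by
        apply mul_le_mul _ hu (hg0 _ _) (by positivity)
        linarith
      have h5 : θ / 32 * ε * θ * e ≤ W * i := by
        rw [hWd]
        have := hwθ m (by omega)
        gcongr
      have h6 : θ ^ 2 / 256 * t = θ / 32 * ε * θ * e / 8 := by rw [ht]; ring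
      rw [e1]
      have := mul_nonneg hp.le hW0
      linarith
    · subst h
      have e1 : av n k g Op.OI k Op.OI = θ / 32 * ε * w k := by
        rw [av_eq]
        simp only [dn, up]
        rw [if_neg (by omega), if_neg (by omega), gIhigh k le_rfl]
        ring
      have e2 : av n k g Op.OI k Op.OW = ε * θ / 16 := by
        rw [av_eq]
        simp only [dn, up]
        rw [if_neg (by omega), if_neg (by omega), gWm]
        ring
      rw [e1, e2, gIhigh k le_rfl]
      have h1 : θ / 32 * ε * w k ≤ θ / 32 * ε := mul_le_of_le_one_right hγ0.le (hw1 k)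
      have h2 : p * (θ / 32 * ε) ≤ p * (ε * θ / 16 - θ / 32 * ε * w k) := by
        gcongr; linarith
      have h3 : a * e * (θ / 32 * ε) ≤ p * (θ / 32 * ε) := by gcongr
      have h4 : a * θ ^ 2 / 256 * t ≤ a * e * (θ / 32 * ε) := by
        have : a * e * (θ / 32 * ε) = a * (8 * θ) / 256 * t := by rw [ht]; ring
        rw [this]; gcongr; linarith
      linarith
    · have e1 : av n m g Op.OI k Op.OI =
          θ / 32 * ε * ((k * i) * w (k - 1) + (1 - k * i) * w k) := by
        rw [av_eq]
        simp only [dn, up]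
        rw [if_pos (Or.inl h), if_neg (by omega), gIhigh (k - 1) (by omega), gIhigh k h.le]
        ring
      rw [e1, gIhigh k h.le]
      have h1 := mul_le_mul_of_nonneg_left (hnet p k hp hpb' hp2 hk hkn) hγ0.le
      have h2 : θ ^ 2 / 256 * t ≤ θ / 32 * ε * (θ * e) := by
        have : θ / 32 * ε * (θ * e) = θ ^ 2 / 32 * t := by rw [ht]; ring
        rw [this]; gcongr; norm_num
      have := mul_nonneg hp.le hW0
      linarith
  · intro k hk hkn
    have hki : (k : ℝ) * i ≤ 1 := by
      rw [← hni]; have : (k : ℝ) ≤ n := by exact_mod_cast hkn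
      gcongr
    have hW0 := av_nonneg (m := m) hn0 g hg0 Op.OW Op.OW k hkn
    have hI0 := av_nonneg (m := m) hn0 g hg0 Op.OW Op.OI k hkn
    rcases (show k = 1 ∨ (2 ≤ k ∧ k < m) ∨ k = m ∨ m < k by omega) with h | ⟨h1, h2⟩ | h | h
    · subst h
      have e1 : ∀ o, av n m g Op.OW 1 o = g 1 o := by
        intro o
        rw [av_eq]
        simp only [dn, up]
        rw [if_neg (by omega), if_neg (by omega)]
        ring
      rw [e1, e1, gI1, gWlow 1 le_rfl (by omega)]
      have h1 : w 1 * i ≤ i := mul_le_of_le_one_left hi0.le (hw1 1)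
      have h2 : q * (i / 4) ≤ q * (i / 2 - w 1 * i / 4) := by gcongr; linarith
      have h3 : a * e * (ε / 2) ≤ q * (i / 4) := by gcongr ?_ * ?_; linarith
      have h4 : a * θ ^ 2 / 256 * t ≤ a * e * (ε / 2) := by
        have : a * e * (ε / 2) = a * 128 / 256 * t := by rw [ht]; ring
        rw [this]; gcongr; linarith
      linarith
    · have e1 : av n m g Op.OW k Op.OW =
          i / 4 * ((k * i) * w (k - 1) + (1 - k * i) * w k) := by
        rw [av_eq]
        simp only [dn, up]
        rw [if_pos ⟨h1, h2.le⟩, if_neg (by omega), gWlow (k - 1) (by omega) (by omega),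
          gWlow k hk h2]
        ring
      rw [e1, gWlow k hk h2]
      have h1 := mul_le_mul_of_nonneg_left (hnet q k hq hqb' hq2 hk hkn)
        (show (0 : ℝ) ≤ i / 4 by positivity)
      have h2 : θ ^ 2 / 256 * t ≤ i / 4 * (θ * e) := by
        have : θ ^ 2 / 256 * t ≤ θ / 4 * t := by gcongr ?_ * t; linarith
        have : θ / 4 * t ≤ θ / 4 * (i * e) := by rw [ht]; gcongr; linarith
        linarith
      have := mul_nonneg hq.le hI0
      linarith
    · subst h
      have e1 : ε * θ / 4 ≤ av n k g Op.OW k Op.OW := by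
        have h1 := av_ge (m := k) hn0 g hg0 Op.OW Op.OW k hkn
        simp only [dn] at h1
        rw [if_pos ⟨hm, le_rfl⟩, gWlow (k - 1) (by omega) (by omega)] at h1
        refine le_trans ?_ h1
        have h2 : (k : ℝ) / n * (w (k - 1) * i / 4) = ε * w (k - 1) / 4 := by
          rw [hεm, hi]; ring
        rw [h2]
        have := hwθ (k - 1) (by omega)
        gcongr
      rw [gWm]
      have h1 : 1 / 2 * (ε * θ / 4) ≤ (1 - q) * av n k g Op.OW k Op.OW := by
        apply mul_le_mul _ e1 (by positivity) (by linarith)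
        linarith
      have h2 : θ ^ 2 / 256 * t ≤ ε * θ / 16 := by
        have h3 : t ≤ ε := by rw [ht]; exact mul_le_of_le_one_right hε0.le (by linarith)
        have : θ ^ 2 / 256 * t ≤ θ / 16 * ε := by gcongr ?_ * ?_; linarith
        linarith
      have := mul_nonneg hq.le hI0
      linarith
    · have e1 : θ / 32 * ε * θ ≤ av n m g Op.OW k Op.OI := by
        rw [av_eq]
        simp only [dn, up]
        rw [if_neg (by omega), if_pos h.le, gIhigh k h.le, gIhigh (k + 1) (by omega)]
        have h1 : (k * i) * (θ / 32 * ε * θ) ≤ (k * i) * (θ / 32 * ε * w k) := by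
          have := hwθ k hkn
          gcongr
        have h2 : (1 - k * i) * (θ / 32 * ε * θ) ≤ (1 - k * i) * (θ / 32 * ε * w (k + 1)) := by
          rcases Nat.lt_or_ge k n with hlt | hge
          · have := hwθ (k + 1) hlt
            have : 0 ≤ 1 - (k : ℝ) * i := by linarith
            gcongr
          · have : k = n := by omega
            rw [this, hni]; simp
        linarith
      rw [gWhigh k h]
      have h1 : a * e * (θ / 32 * ε * θ) ≤ q * av n m g Op.OW k Op.OI := by gcongr
      have h2 : a * θ ^ 2 / 256 * t ≤ a * e * (θ / 32 * ε * θ) := by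
        have : a * e * (θ / 32 * ε * θ) = a * θ ^ 2 / 32 * t := by rw [ht]; ring
        rw [this]; gcongr; norm_num
      have := mul_nonneg (by linarith : 0 ≤ 1 - q) hW0
      linarith

theorem exists_w (n : ℕ) (β : ℝ) (hβ : 0 ≤ β) (hL : 1 ≤ Real.log n) :
    ∃ w : ℕ → ℝ, (∀ k, 0 ≤ w k) ∧ (∀ k, w k ≤ 1) ∧ (∀ k ≤ n, Real.exp (-(2 * β)) ≤ w k) ∧
      ∀ k : ℕ, β / Real.log n * w (k + 1) ≤ ((k + 1 : ℕ) : ℝ) * (w k - w (k + 1)) := by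
  have hL0 : 0 < Real.log n := by linarith
  have hH0 : ∀ k, (0 : ℝ) ≤ (harmonic k : ℝ) := by
    intro k
    have : (0 : ℚ) ≤ harmonic k := by
      unfold harmonic; positivity
    exact_mod_cast this
  refine ⟨fun k => Real.exp (-(β / Real.log n * (harmonic k : ℝ))), fun k => (Real.exp_pos _).le,
    fun k => ?_, fun k hk => ?_, fun k => ?_⟩
  · rw [Real.exp_le_one_iff]
    have := hH0 k
    have : 0 ≤ β / Real.log n * (harmonic k : ℝ) := by positivity
    linarith
  · rw [Real.exp_le_exp, neg_le_neg_iff]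
    have h1 : (harmonic k : ℝ) ≤ 2 * Real.log n := by
      have h2 := harmonic_le_one_add_log k
      have h3 : Real.log k ≤ Real.log n := by
        rcases Nat.eq_zero_or_pos k with rfl | h
        · simpa using hL0.le
        · apply Real.log_le_log (by exact_mod_cast h) (by exact_mod_cast hk)
      linarith
    calc β / Real.log n * (harmonic k : ℝ) ≤ β / Real.log n * (2 * Real.log n) := by gcongr
      _ = 2 * β := by field_simp
  · have hk : (0 : ℝ) < ((k + 1 : ℕ) : ℝ) := by positivity
    have h1 : (harmonic (k + 1) : ℝ) = harmonic k + 1 / ((k + 1 : ℕ) : ℝ) := by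
      rw [harmonic_succ]; push_cast; ring
    simp only
    have h2 : Real.exp (-(β / Real.log n * (harmonic k : ℝ))) =
        Real.exp (-(β / Real.log n * (harmonic (k + 1) : ℝ))) *
          Real.exp (β / Real.log n / ((k + 1 : ℕ) : ℝ)) := by
      rw [← Real.exp_add, h1]; congr 1; ring
    rw [h2]
    set E := Real.exp (-(β / Real.log n * (harmonic (k + 1) : ℝ))) with hE
    have hE0 : 0 < E := Real.exp_pos _
    have h3 := Real.add_one_le_exp (β / Real.log n / ((k + 1 : ℕ) : ℝ))
    have h4 : E * (β / Real.log n / ((k + 1 : ℕ) : ℝ)) ≤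
        E * (Real.exp (β / Real.log n / ((k + 1 : ℕ) : ℝ)) - 1) := by
      gcongr; linarith
    have h5 := mul_le_mul_of_nonneg_left h4 hk.le
    have h6 : ((k + 1 : ℕ) : ℝ) * (E * (β / Real.log n / ((k + 1 : ℕ) : ℝ))) =
        β / Real.log n * E := by field_simp
    rw [h6] at h5
    linarith

end Large

/-- Runtime of the MMAHH with OI+OW on `Jump_m`. -/
theorem mmahh_oi_ow_jump (a b : ℝ) (ha : 0 < a) (hab : a ≤ b) :
    ∃ C : ℝ, 0 < C ∧
      ∀ (n m : ℕ), 4 ≤ n → 2 ≤ m → 2 * m ≤ n →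
        ∀ (p q : ℝ), 0 < p → p < 1 → 0 < q → q < 1 →
            a / ((n : ℝ) * Real.log n) ≤ p → p ≤ b / ((n : ℝ) * Real.log n) →
            a / ((n : ℝ) * Real.log n) ≤ q → q ≤ b / ((n : ℝ) * Real.log n) →
            ∀ (Ω : Type) [MeasurableSpace Ω] (μ : Measure Ω) (X : ℕ → Ω → Point n × Op),
              IsProbabilityMeasure μ →
              IsMMAHH μ X (Jump n m) p q →
              (∀ x0 : Point n, μ {ω | X 0 ω = (x0, Op.OI)} = 1 / 2 ^ n) →
              ∫⁻ ω, (hitTime X ω : ℝ≥0∞) ∂μ ≤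
                ENNReal.ofReal (C * ((n : ℝ) ^ 3 / (m : ℝ)) * Real.log n) := by
  classical
  have hb : 0 < b := lt_of_lt_of_le ha hab
  set θ : ℝ := Real.exp (-(2 * (2 * b + 2))) with hθ
  have hθ0 : 0 < θ := Real.exp_pos _
  have hmin0 : 0 < min 1 a := lt_min one_pos ha
  set c : ℝ := min 1 a * θ ^ 2 / 256 with hc
  have hc0 : 0 < c := by positivity
  obtain ⟨N0, hN0⟩ : ∃ N0 : ℕ, ∀ n : ℕ, N0 ≤ n → max 1 (8 * b) ≤ Real.log n := by
    have h : Filter.Tendsto (fun n : ℕ => Real.log n) Filter.atTop Filter.atTop :=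
      Real.tendsto_log_atTop.comp tendsto_natCast_atTop_atTop
    exact Filter.eventually_atTop.1 (h.eventually_ge_atTop _)
  have hsmall : ∀ n : ℕ, ∃ M : ℝ, 0 ≤ M ∧ (4 ≤ n → ∀ m : ℕ, 2 ≤ m → 2 * m ≤ n →
      ∀ p q : ℝ, 0 < p → p < 1 → 0 < q → q < 1 →
      a / ((n : ℝ) * Real.log n) ≤ p → a / ((n : ℝ) * Real.log n) ≤ q →
      ∀ (Ω : Type) [MeasurableSpace Ω] (μ : Measure Ω)
        (X : ℕ → Ω → Point n × Op), IsProbabilityMeasure μ → IsMMAHH μ X (Jump n m) p q →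
        ∫⁻ ω, (hitTime X ω : ℝ≥0∞) ∂μ ≤ ENNReal.ofReal M) := by
    intro n
    by_cases hn : 4 ≤ n
    · have hn' : (4 : ℝ) ≤ n := by exact_mod_cast hn
      have hlog : 0 < Real.log n := Real.log_pos (by linarith)
      obtain ⟨M, hM0, hM⟩ := runtime_small n hn (a / ((n : ℝ) * Real.log n)) (by positivity)
      exact ⟨M, hM0, fun _ => hM⟩
    · exact ⟨0, le_rfl, fun h => absurd h hn⟩
  choose M hM0 hM using hsmall
  have hS : 0 ≤ ∑ n ∈ Finset.range N0, M n := Finset.sum_nonneg fun n _ => hM0 n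
  refine ⟨1 / c + ∑ n ∈ Finset.range N0, M n, by positivity, ?_⟩
  intro n m hn hm hmn p q hp hp1 hq hq1 hpa hpb hqa hqb Ω _ μ X hμ hX _
  have hn' : (4 : ℝ) ≤ n := by exact_mod_cast hn
  have hm' : (2 : ℝ) ≤ m := by exact_mod_cast hm
  have hmn' : 2 * (m : ℝ) ≤ n := by exact_mod_cast hmn
  have hlog1 : 1 ≤ Real.log n := by
    rw [Real.le_log_iff_exp_le (by linarith)]
    linarith [Real.exp_one_lt_d9]
  have hr : 1 ≤ (n : ℝ) ^ 3 / m := by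
    rw [one_le_div (by linarith)]
    nlinarith [sq_nonneg (n : ℝ)]
  by_cases hnN : n < N0
  · refine (hM n hn m hm hmn p q hp hp1 hq hq1 hpa hqa Ω μ X hμ hX).trans
      (ENNReal.ofReal_le_ofReal ?_)
    have h1 : M n ≤ ∑ n ∈ Finset.range N0, M n :=
      Finset.single_le_sum (fun n _ => hM0 n) (Finset.mem_range.2 hnN)
    have h2 : M n ≤ 1 / c + ∑ n ∈ Finset.range N0, M n := by
      have : 0 < 1 / c := by positivity
      linarith
    have h3 : 0 ≤ 1 / c + ∑ n ∈ Finset.range N0, M n := (hM0 n).trans h2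
    calc M n ≤ (1 / c + ∑ n ∈ Finset.range N0, M n) * 1 * 1 := by linarith
      _ ≤ _ := by gcongr
  · have hbig := hN0 n (not_lt.1 hnN)
    obtain ⟨w, hw0, hw1, hwθ, hw⟩ := exists_w n (2 * b + 2) (by positivity) hlog1
    obtain ⟨h1, h2, h3, h4⟩ := pot_drift hm hmn w ha hlog1 ((le_max_right _ _).trans hbig) hp hq
      hpa hpb hqa hqb hθ0 hw0 hw1 hwθ hw _ rfl _ rfl
    refine (runtime_of_drift hm hmn hp hp1 hq hq1 _ _ (by positivity) h1 h2 h3 h4 μ X hX).trans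
      (ENNReal.ofReal_le_ofReal ?_)
    calc 1 / (min 1 a * θ ^ 2 / 256 * (m / (n : ℝ) ^ 2) / (n * Real.log n))
        = 1 / c * ((n : ℝ) ^ 3 / m) * Real.log n := by
          rw [← hc]; field_simp
      _ ≤ _ := by gcongr; linarith
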